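/- Let N be a finite von Neumann algebra with normal faithful tracial state, u ∈ M_3(N) unitary, and b = (u − u^T)/2. Then ‖b‖_2² ≤ 25/27, where ‖·‖_2 is the norm from τ_3 ⊗ τ_N. In the finite-dimensional case N = M_k(ℂ): for every unitary u ∈ M_3(ℂ) ⊗ M_k(ℂ), the anti-symmetric part b = (u − u^T)/2 (transpose taken only in the M_3 factor) satisfies (τ_3 ⊗ τ_k)(b*b) ≤ 25/27. -/

import Mathlib

open Matrix BigOperators

noncomputable section

/-- The trace `τ₃ ⊗ τ_N` on `M₃(N)`. -/
def trN {N : Type*} [CStarAlgebra N] (τ : N →ₗ[ℂ] ℂ)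
    (M : Matrix (Fin 3) (Fin 3) N) : ℂ :=
  (3 : ℂ)⁻¹ * ∑ i, τ (M i i)

/-- A completely positive map in Kraus form is bounded by its value at `1`, on unitaries. -/
lemma norm_sum_mul_mul_star_le {A ι : Type*} [CStarAlgebra A] [Fintype ι]
    {v : A} (hv : v ∈ unitary A) (a : ι → A) :
    ‖∑ i, a i * v * star (a i)‖ ≤ ‖∑ i, a i * star (a i)‖ := by
  let := CStarAlgebra.spectralOrder A
  let := CStarAlgebra.spectralOrderedRing A
  let x : WithCStarModule A (ι → A) := (WithCStarModule.equiv A (ι → A)).symm a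
  let y : WithCStarModule A (ι → A) := (WithCStarModule.equiv A (ι → A)).symm fun i => a i * v
  have hx : ‖x‖ ^ 2 = ‖∑ i, a i * star (a i)‖ := WithCStarModule.pi_norm_sq x
  have hy : ‖y‖ ^ 2 = ‖∑ i, a i * star (a i)‖ := by
    refine (WithCStarModule.pi_norm_sq y).trans (congrArg norm (Finset.sum_congr rfl fun i _ => ?_))
    change a i * v * star (a i * v) = _
    rw [star_mul, mul_assoc, ← mul_assoc v, Unitary.mul_star_self_of_mem hv, one_mul]
  have hxy : ‖x‖ = ‖y‖ := by
    rw [← sq_eq_sq₀ (norm_nonneg _) (norm_nonneg _), hx, hy]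
  have h := CStarModule.norm_inner_le (A := A) (WithCStarModule A (ι → A)) (x := x) (y := y)
  rw [← hxy, ← sq, hx] at h
  exact h

lemma re_map_star {A : Type*} [CStarAlgebra A] (φ : A →ₗ[ℂ] ℂ) (hφ1 : φ 1 = 1)
    (hφpos : ∀ a : A, 0 ≤ (φ (star a * a)).re ∧ (φ (star a * a)).im = 0) (a : A) :
    (φ (star a)).re = (φ a).re := by
  have h := (hφpos (a + Complex.I • 1)).2
  have h1 : star (a + Complex.I • (1 : A)) * (a + Complex.I • 1) =
      star a * a + Complex.I • star a - Complex.I • a + 1 := by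
    simp only [star_add, star_smul, star_one, Complex.star_def, Complex.conj_I, add_mul, mul_add,
      smul_mul_assoc, mul_smul_comm, mul_one, one_mul]
    match_scalars <;> simp
  rw [h1] at h
  simp [(hφpos a).2, hφ1] at h
  linarith

lemma cfc_eight_add_sub {A : Type*} [CStarAlgebra A] {T : A} (hT : IsSelfAdjoint T) {p q : ℝ → ℝ}
    (hp : ContinuousOn p (spectrum ℝ T)) (hq : ContinuousOn q (spectrum ℝ T)) :
    cfc (fun t => 8 + 11 * t - t * t - 9 * (q t * t * q t + p t * p t)) T =
      8 + (11 : ℝ) • T - T * T - (9 : ℝ) • (cfc q T * T * cfc q T + cfc p T * cfc p T) := by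
  have hid : cfc (fun t : ℝ => t) T = T := cfc_id' ℝ T
  have h8 : cfc (fun _ : ℝ => (8 : ℝ)) T = 8 := by rw [cfc_const 8 T, map_ofNat]
  have hqt : cfc (fun t => q t * t) T = cfc q T * T := by rw [cfc_mul q (fun t => t) T, hid]
  have hqtq : cfc (fun t => q t * t * q t) T = cfc q T * T * cfc q T := by
    rw [cfc_mul (fun t => q t * t) q T, hqt]
  have hpp : cfc (fun t => p t * p t) T = cfc p T * cfc p T := cfc_mul p p T
  have htt : cfc (fun t : ℝ => t * t) T = T * T := by
    rw [cfc_mul (fun t => t) (fun t => t) T, hid]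
  have h11 : cfc (fun t : ℝ => 11 * t) T = (11 : ℝ) • T := by
    rw [cfc_const_mul 11 (fun t => t) T, hid]
  have h9 : cfc (fun t => 9 * (q t * t * q t + p t * p t)) T =
      (9 : ℝ) • (cfc q T * T * cfc q T + cfc p T * cfc p T) := by
    rw [cfc_const_mul 9 (fun t => q t * t * q t + p t * p t) T,
      cfc_add T (fun t => q t * t * q t) (fun t => p t * p t), hqtq, hpp]
  rw [cfc_sub (fun t => 8 + 11 * t - t * t) (fun t => 9 * (q t * t * q t + p t * p t)) T,
    cfc_sub (fun t => 8 + 11 * t) (fun t => t * t) T,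
    cfc_add T (fun _ => 8) (fun t => 11 * t), h8, h11, htt, h9]

/-- The trace form of `(w - 1)² (w - 2) (w + 4) ≤ 0` for `w = |x|`, with `φ(|x|)` bounded below by
`Re φ(u⋆x)`. Instead of the polar decomposition, the proof uses `2 w ≤ g + w² / g` with
`g = (w² + 2) / 3`. -/
lemma eighteen_mul_re_le {A : Type*} [CStarAlgebra A] (φ : A →ₗ[ℂ] ℂ) (hφ1 : φ 1 = 1)
    (hφtr : ∀ a b : A, φ (a * b) = φ (b * a))
    (hφpos : ∀ a : A, 0 ≤ (φ (star a * a)).re ∧ (φ (star a * a)).im = 0)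
    {u x : A} (hu : u ∈ unitary A) (hx : ‖x‖ ≤ 2) :
    18 * (φ (star u * x)).re ≤
      8 + 11 * (φ (star x * x)).re - (φ (star x * x * (star x * x))).re := by
  let := CStarAlgebra.spectralOrder A
  let := CStarAlgebra.spectralOrderedRing A
  set T := star x * x with hT
  have hTsa : IsSelfAdjoint T := .star_mul_self x
  have hTspec : ∀ t ∈ spectrum ℝ T, 0 ≤ t ∧ t ≤ 4 := by
    intro t ht
    refine ⟨spectrum_nonneg_of_nonneg (star_mul_self_nonneg x) ht, ?_⟩
    have : Nontrivial A := ⟨1, 0, fun h => by simp [h] at hφ1⟩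
    have h1 := spectrum.norm_le_norm_of_mem ht
    rw [hT, CStarRing.norm_star_mul_self] at h1
    have h2 := le_abs_self t
    rw [Real.norm_eq_abs] at h1
    nlinarith [norm_nonneg x]
  let p : ℝ → ℝ := fun t => √((t + 2) / 3)
  let q : ℝ → ℝ := fun t => (√((t + 2) / 3))⁻¹
  have hg : ∀ t ∈ spectrum ℝ T, 0 < √((t + 2) / 3) := fun t ht =>
    Real.sqrt_pos.2 (by linarith [(hTspec t ht).1])
  have hpc : ContinuousOn p (spectrum ℝ T) := by fun_prop
  have hqc : ContinuousOn q (spectrum ℝ T) := hpc.inv₀ fun t ht => (hg t ht).ne'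
  have hpq : cfc p T * cfc q T = 1 := by
    rw [← cfc_mul p q T, ← cfc_one ℝ T]
    exact cfc_congr fun t ht => mul_inv_cancel₀ (hg t ht).ne'
  have hqp : cfc q T * cfc p T = 1 := by rw [cfc_commute_cfc q p T, hpq]
  have hp : star (cfc p T) = cfc p T := (cfc_predicate p T : IsSelfAdjoint _)
  have hq : star (cfc q T) = cfc q T := (cfc_predicate q T : IsSelfAdjoint _)
  set P := cfc p T
  set Q := cfc q T
  have hyoung := (hφpos (x * Q - u * P)).1
  have hexp : φ (star (x * Q - u * P) * (x * Q - u * P)) =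
      φ (Q * T * Q + P * P) - φ (star x * u) - φ (star u * x) := by
    have h1 : star (x * Q - u * P) * (x * Q - u * P) = (Q * T * Q + P * (star u * u) * P)
        - Q * (star x * u * P) - (P * (star u * x)) * Q := by
      rw [star_sub, star_mul, star_mul, hp, hq]
      simp only [hT, sub_mul, mul_sub, mul_assoc]
      abel
    have h2 : φ (Q * (star x * u * P)) = φ (star x * u) := by
      rw [hφtr, mul_assoc, hpq, mul_one]
    have h3 : φ (P * (star u * x) * Q) = φ (star u * x) := by
      rw [hφtr, ← mul_assoc, hqp, one_mul]
    rw [h1, Unitary.star_mul_self_of_mem hu, mul_one, map_sub, map_sub, h2, h3]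
  have hstar : (φ (star x * u)).re = (φ (star u * x)).re := by
    rw [← re_map_star φ hφ1 hφpos (star u * x), star_mul, star_star]
  have hpoly : 0 ≤ (φ (8 + (11 : ℝ) • T - T * T - (9 : ℝ) • (Q * T * Q + P * P))).re := by
    let r : ℝ → ℝ := fun t => 8 + 11 * t - t * t - 9 * (q t * t * q t + p t * p t)
    have hr : cfc r T = 8 + (11 : ℝ) • T - T * T - (9 : ℝ) • (Q * T * Q + P * P) :=
      cfc_eight_add_sub hTsa hpc hqc
    have hr0 : ∀ t ∈ spectrum ℝ T, 0 ≤ r t := by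
      intro t ht
      obtain ⟨h0, h4⟩ := hTspec t ht
      have hs : √((t + 2) / 3) * √((t + 2) / 3) = (t + 2) / 3 := Real.mul_self_sqrt (by linarith)
      have : r t = (t - 1) ^ 2 * (4 - t) / (t + 2) := by
        have : q t * t * q t = t * ((t + 2) / 3)⁻¹ := by
          rw [← hs, mul_inv]; ring
        simp only [r, this, p, hs]
        field_simp
        ring
      rw [this]
      have : 0 ≤ 4 - t := by linarith
      positivity
    obtain ⟨s, hs⟩ := CStarAlgebra.nonneg_iff_eq_star_mul_self.mp (cfc_nonneg hr0)
    rw [← hr, hs]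
    exact (hφpos s).1
  have h8 : (φ 8).re = 8 := by
    have : (8 : A) = (8 : ℂ) • 1 := by
      rw [← Algebra.algebraMap_eq_smul_one, map_ofNat]
    rw [this, map_smul, hφ1]
    simp
  rw [hexp] at hyoung
  simp only [map_sub, map_add, LinearMap.map_smul_of_tower, Complex.sub_re,
    Complex.add_re, Complex.smul_re, h8, smul_eq_mul] at hpoly hyoung
  linarith

/-- Kraus operators of the completely positive map `x ↦ (tr(x) 1 - xᵀ) / 2` on `M₃(N)`. -/
def antisymmKraus (N : Type*) [CStarAlgebra N] (k : Fin 3 × Fin 3) : Matrix (Fin 3) (Fin 3) N :=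
  (2 : ℂ)⁻¹ • (single k.1 k.2 1 - single k.2 k.1 1)

/-- Kraus operators of the completely positive map `x ↦ (tr(x) 1 + xᵀ) / 2 - x / 3` on `M₃(N)`. -/
def symmKraus (N : Type*) [CStarAlgebra N] (k : Fin 3 × Fin 3) : Matrix (Fin 3) (Fin 3) N :=
  (2 : ℂ)⁻¹ • (single k.1 k.2 1 + single k.2 k.1 1) - if k.1 = k.2 then (3 : ℂ)⁻¹ • 1 else 0

lemma sum_antisymmKraus {N : Type*} [CStarAlgebra N] (x : Matrix (Fin 3) (Fin 3) N) :
    ∑ k, antisymmKraus N k * x * (antisymmKraus N k)ᴴ =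
      (2 : ℂ)⁻¹ • (diagonal (fun _ => x.trace) - xᵀ) := by
  have h (k : Fin 3 × Fin 3) : antisymmKraus N k * x * (antisymmKraus N k)ᴴ =
      (4 : ℂ)⁻¹ • (single k.1 k.1 (x k.2 k.2) - single k.1 k.2 (x k.2 k.1)
        - single k.2 k.1 (x k.1 k.2) + single k.2 k.2 (x k.1 k.1)) := by
    simp only [antisymmKraus, conjTranspose_smul, conjTranspose_sub, conjTranspose_single, star_one,
      smul_mul_assoc, mul_smul_comm, sub_mul, mul_sub, single_mul_mul_single, one_mul, mul_one,
      star_inv₀, star_ofNat]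
    module
  simp only [h]
  rw [Fintype.sum_prod_type]
  ext i j
  fin_cases i <;> fin_cases j <;>
    simp [Fin.sum_univ_three, trace] <;> module

lemma sum_symmKraus {N : Type*} [CStarAlgebra N] (x : Matrix (Fin 3) (Fin 3) N) :
    ∑ k, symmKraus N k * x * (symmKraus N k)ᴴ =
      (2 : ℂ)⁻¹ • (diagonal (fun _ => x.trace) + xᵀ) - (3 : ℂ)⁻¹ • x := by
  have h (k : Fin 3 × Fin 3) : symmKraus N k * x * (symmKraus N k)ᴴ =
      (4 : ℂ)⁻¹ • (single k.1 k.1 (x k.2 k.2) + single k.1 k.2 (x k.2 k.1)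
        + single k.2 k.1 (x k.1 k.2) + single k.2 k.2 (x k.1 k.1)) +
      if k.1 = k.2 then (9 : ℂ)⁻¹ • x -
        (3 : ℂ)⁻¹ • (single k.1 k.1 1 * x + x * single k.1 k.1 1) else 0 := by
    obtain ⟨i, j⟩ := k
    by_cases hij : i = j
    · subst hij
      simp only [symmKraus, if_true, conjTranspose_smul, conjTranspose_add, conjTranspose_sub,
        conjTranspose_single, star_one, smul_mul_assoc, mul_smul_comm, add_mul, mul_add, sub_mul,
        mul_sub, single_mul_mul_single, one_mul, mul_one,
        conjTranspose_one, star_inv₀, star_ofNat]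
      module
    · simp only [symmKraus, if_neg hij, sub_zero, add_zero, conjTranspose_smul,
        conjTranspose_add, conjTranspose_single, star_one,
        smul_mul_assoc, mul_smul_comm, add_mul, mul_add, single_mul_mul_single, one_mul, mul_one,
        star_inv₀, star_ofNat]
      module
  simp only [h]
  rw [Fintype.sum_prod_type]
  ext i j
  fin_cases i <;> fin_cases j <;>
    simp [Fin.sum_univ_three, single_apply, trace, Matrix.mul_apply] <;> module

lemma smul_sub_transpose_eq {N : Type*} [CStarAlgebra N] (x : Matrix (Fin 3) (Fin 3) N) :
    (2 : ℂ)⁻¹ • (x - xᵀ) = (2 : ℂ)⁻¹ • ((2 / 3 : ℂ) • x +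
      ∑ k, antisymmKraus N k * x * (antisymmKraus N k)ᴴ
      - ∑ k, symmKraus N k * x * (symmKraus N k)ᴴ) := by
  rw [sum_antisymmKraus, sum_symmKraus]
  module

lemma diagonal_trace_one (N : Type*) [CStarAlgebra N] :
    diagonal (fun _ : Fin 3 => (1 : Matrix (Fin 3) (Fin 3) N).trace) = (3 : ℂ) • 1 := by
  ext i j
  by_cases hij : i = j
  · subst hij
    rw [diagonal_apply_eq, trace_one, Matrix.smul_apply, one_apply_eq, Fintype.card_fin,
      ← Algebra.algebraMap_eq_smul_one, map_ofNat, Nat.cast_ofNat]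
  · simp [hij]

lemma sum_antisymmKraus_one (N : Type*) [CStarAlgebra N] :
    ∑ k, antisymmKraus N k * (antisymmKraus N k)ᴴ = 1 := by
  have h := sum_antisymmKraus (1 : Matrix (Fin 3) (Fin 3) N)
  simp only [mul_one] at h
  rw [h, diagonal_trace_one, transpose_one]
  module

lemma sum_symmKraus_one (N : Type*) [CStarAlgebra N] :
    ∑ k, symmKraus N k * (symmKraus N k)ᴴ = (5 / 3 : ℂ) • 1 := by
  have h := sum_symmKraus (1 : Matrix (Fin 3) (Fin 3) N)
  simp only [mul_one] at h
  rw [h, diagonal_trace_one, transpose_one]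
  module

lemma norm_half_sub_transpose_le {N : Type*} [CStarAlgebra N] [PartialOrder N] [StarOrderedRing N]
    [Nontrivial N]
    {u : CStarMatrix (Fin 3) (Fin 3) N} (hu : u ∈ unitary (CStarMatrix (Fin 3) (Fin 3) N)) :
    ‖(2 : ℂ)⁻¹ • (u - u.transpose)‖ ≤ 5 / 3 := by
  let a (k : Fin 3 × Fin 3) : CStarMatrix (Fin 3) (Fin 3) N := .ofMatrix (antisymmKraus N k)
  let s (k : Fin 3 × Fin 3) : CStarMatrix (Fin 3) (Fin 3) N := .ofMatrix (symmKraus N k)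
  have ha1 : ∑ k, a k * star (a k) = 1 := sum_antisymmKraus_one N
  have hs1 : ∑ k, s k * star (s k) = (5 / 3 : ℂ) • 1 := sum_symmKraus_one N
  have ha := norm_sum_mul_mul_star_le hu a
  have hs := norm_sum_mul_mul_star_le hu s
  have hu1 : ‖u‖ ≤ 1 := CStarRing.norm_of_mem_unitary hu |>.le
  have heq : (2 : ℂ)⁻¹ • (u - u.transpose) = (2 : ℂ)⁻¹ • ((2 / 3 : ℂ) • u +
      ∑ k, a k * u * star (a k) - ∑ k, s k * u * star (s k)) :=
    smul_sub_transpose_eq (CStarMatrix.ofMatrix.symm u)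
  rw [ha1, CStarRing.norm_one] at ha
  rw [hs1, norm_smul] at hs
  norm_num at hs
  rw [heq, norm_smul]
  have h1 := norm_sub_le ((2 / 3 : ℂ) • u + ∑ k, a k * u * star (a k)) (∑ k, s k * u * star (s k))
  have h2 := norm_add_le ((2 / 3 : ℂ) • u) (∑ k, a k * u * star (a k))
  rw [norm_smul] at h2
  norm_num at h2 ⊢
  linarith

lemma trN_conjTranspose_mul_half_sub_transpose {N : Type*} [CStarAlgebra N] (τ : N →ₗ[ℂ] ℂ)
    (u : Matrix (Fin 3) (Fin 3) N) :
    trN τ (uᴴ * (2 : ℂ)⁻¹ • (u - uᵀ)) =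
      trN τ (((2 : ℂ)⁻¹ • (u - uᵀ))ᴴ * (2 : ℂ)⁻¹ • (u - uᵀ)) := by
  simp [trN, Matrix.mul_apply, Fin.sum_univ_three, mul_sub, sub_mul]
  ring

lemma re_sq_le {A : Type*} [CStarAlgebra A] (φ : A →ₗ[ℂ] ℂ) (hφ1 : φ 1 = 1)
    (hφpos : ∀ a : A, 0 ≤ (φ (star a * a)).re) {s : A} (hs : IsSelfAdjoint s) :
    (φ s).re ^ 2 ≤ (φ (s * s)).re := by
  have h := hφpos (s - ((φ s).re : ℂ) • 1)
  have h1 : star (s - ((φ s).re : ℂ) • 1) * (s - ((φ s).re : ℂ) • 1) =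
      s * s - (2 * (φ s).re : ℂ) • s + ((φ s).re ^ 2 : ℂ) • 1 := by
    simp only [star_sub, star_smul, star_one, hs.star_eq, Complex.star_def, Complex.conj_ofReal,
      sub_mul, mul_sub, smul_mul_assoc, mul_smul_comm, mul_one, one_mul]
    module
  rw [h1, map_add, map_sub, map_smul, map_smul, hφ1] at h
  norm_cast at h
  simp at h
  norm_cast at h
  nlinarith

lemma three_halves_mul_sq_le {N : Type*} [CStarAlgebra N]
    (τ : N →ₗ[ℂ] ℂ) (hτ1 : τ 1 = 1) (hτtr : ∀ a b : N, τ (a * b) = τ (b * a))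
    (hτpos : ∀ a : N, 0 ≤ (τ (star a * a)).re)
    {b : Matrix (Fin 3) (Fin 3) N} (hb : bᵀ = -b) :
    3 / 2 * (trN τ (bᴴ * b)).re ^ 2 ≤ (trN τ (bᴴ * b * (bᴴ * b))).re := by
  have hanti (i j : Fin 3) : b i j = -b j i := by
    simpa using congrFun (congrFun hb j) i
  have hdiag (i : Fin 3) : b i i = 0 := by
    have h : (2 : ℂ) • b i i = 0 := by rw [two_smul]; nth_rw 1 [hanti i i]; simp
    exact (smul_eq_zero.mp h).resolve_left two_ne_zero
  set x := b 0 1 with hx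
  set y := b 0 2 with hy
  set z := b 1 2 with hz
  set S := star x * x + star y * y + star z * z with hS
  set S' := x * star x + y * star y + z * star z with hS'
  have h2 : trN τ (bᴴ * b) = 2 / 3 * τ S := by
    simp only [trN, Matrix.mul_apply, Fin.sum_univ_three, conjTranspose_apply, hdiag, hanti 1 0,
      hanti 2 0, hanti 2 1, ← hx, ← hy, ← hz, hS]
    simp
    ring
  have hcyc (a c : N) : τ (star a * (c * (star c * a))) = τ (c * (star c * (a * star a))) := by
    rw [hτtr]
    simp only [mul_assoc]
  have h4 : trN τ (bᴴ * b * (bᴴ * b)) = 3⁻¹ * (τ (S * S) + τ (S' * S')) := by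
    simp only [trN, Matrix.mul_apply, Fin.sum_univ_three, conjTranspose_apply, hdiag, hanti 1 0,
      hanti 2 0, hanti 2 1, ← hx, ← hy, ← hz, hS, hS']
    simp only [star_zero, star_neg, neg_mul, mul_neg, neg_neg, zero_mul, mul_zero, zero_add,
      add_zero, mul_add, add_mul, mul_assoc, map_add, neg_zero]
    linear_combination (3 : ℂ)⁻¹ * (hcyc x x + hcyc y y + hcyc z z + hcyc x y + hcyc y x +
      hcyc x z + hcyc z x + hcyc y z + hcyc z y)
  have hSS := re_sq_le τ hτ1 hτpos (s := S)
    (((IsSelfAdjoint.star_mul_self x).add (.star_mul_self y)).add (.star_mul_self z))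
  have hSS' := re_sq_le τ hτ1 hτpos (s := S')
    (((IsSelfAdjoint.mul_star_self x).add (.mul_star_self y)).add (.mul_star_self z))
  have htr : τ S' = τ S := by simp only [hS, hS', map_add, hτtr (star _)]
  rw [htr] at hSS'
  have hr2 : (trN τ (bᴴ * b)).re = 2 / 3 * (τ S).re := by
    rw [h2, show (2 / 3 : ℂ) = ((2 / 3 : ℝ) : ℂ) by norm_num, Complex.re_ofReal_mul]
  have hr4 : (trN τ (bᴴ * b * (bᴴ * b))).re = 3⁻¹ * ((τ (S * S)).re + (τ (S' * S')).re) := by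
    rw [h4, show (3⁻¹ : ℂ) = ((3⁻¹ : ℝ) : ℂ) by norm_num, Complex.re_ofReal_mul, Complex.add_re]
  rw [hr2, hr4]
  linarith

lemma trN_mul_comm {N : Type*} [CStarAlgebra N] (τ : N →ₗ[ℂ] ℂ)
    (hτtr : ∀ a b : N, τ (a * b) = τ (b * a)) (a b : Matrix (Fin 3) (Fin 3) N) :
    trN τ (a * b) = trN τ (b * a) := by
  simp only [trN, Matrix.mul_apply, map_sum]
  rw [Finset.sum_comm]
  simp only [hτtr]

lemma trN_conjTranspose_mul_self {N : Type*} [CStarAlgebra N] (τ : N →ₗ[ℂ] ℂ)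
    (hτpos : ∀ a : N, 0 ≤ (τ (star a * a)).re ∧ (τ (star a * a)).im = 0)
    (a : Matrix (Fin 3) (Fin 3) N) :
    0 ≤ (trN τ (aᴴ * a)).re ∧ (trN τ (aᴴ * a)).im = 0 := by
  rw [trN, show (3⁻¹ : ℂ) = ((3⁻¹ : ℝ) : ℂ) by norm_num, Complex.re_ofReal_mul,
    Complex.im_ofReal_mul]
  simp only [Matrix.mul_apply, map_sum, Complex.re_sum, Complex.im_sum, conjTranspose_apply]
  refine ⟨mul_nonneg (by norm_num) (Finset.sum_nonneg fun i _ => Finset.sum_nonneg fun j _ =>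
    (hτpos _).1), ?_⟩
  simp [(hτpos _).2]

/-- The trace `trN τ` as a linear functional on the C⋆-algebra `M₃(N)`. -/
def trNLinear {N : Type*} [CStarAlgebra N] (τ : N →ₗ[ℂ] ℂ) :
    CStarMatrix (Fin 3) (Fin 3) N →ₗ[ℂ] ℂ where
  toFun M := trN τ M
  map_add' a b := by
    simp [trN, Fin.sum_univ_three]; ring
  map_smul' c a := by
    simp [trN, Fin.sum_univ_three]; ring

lemma re_trN_le {N : Type*} [CStarAlgebra N]
    (τ : N →ₗ[ℂ] ℂ) (hτ1 : τ 1 = 1) (hτtr : ∀ a b : N, τ (a * b) = τ (b * a))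
    (hτpos : ∀ a : N, 0 ≤ (τ (star a * a)).re ∧ (τ (star a * a)).im = 0)
    (u : Matrix (Fin 3) (Fin 3) N) (hu : uᴴ * u = 1 ∧ u * uᴴ = 1)
    (b : Matrix (Fin 3) (Fin 3) N) (hb : b = (2 : ℂ)⁻¹ • (u - uᵀ)) :
    (trN τ (bᴴ * b)).re ≤ 25 / 27 := by
  let := CStarAlgebra.spectralOrder N
  let := CStarAlgebra.spectralOrderedRing N
  have hu' : CStarMatrix.ofMatrix u ∈ unitary (CStarMatrix (Fin 3) (Fin 3) N) := hu
  have : Nontrivial N := ⟨1, 0, fun h => by simp [h] at hτ1⟩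
  let x : CStarMatrix (Fin 3) (Fin 3) N := (6 / 5 : ℂ) • .ofMatrix b
  have hx : ‖x‖ ≤ 2 := by
    have h := norm_half_sub_transpose_le hu'
    have hxb : x = (6 / 5 : ℂ) • (2 : ℂ)⁻¹ •
        (CStarMatrix.ofMatrix u - (CStarMatrix.ofMatrix u).transpose) := by
      simp only [x, hb]; rfl
    have hc : ‖(6 / 5 : ℂ)‖ = 6 / 5 := by norm_num
    rw [hxb, norm_smul, hc]
    linarith
  have hmain := eighteen_mul_re_le (trNLinear τ)
    (by change trN τ 1 = 1; simp [trN, hτ1]) (trN_mul_comm τ hτtr)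
    (trN_conjTranspose_mul_self τ hτpos) hu' hx
  have hxx : star x * x =
      ((36 / 25 : ℝ) : ℂ) • (star (CStarMatrix.ofMatrix b) * CStarMatrix.ofMatrix b) := by
    simp only [x, star_smul, smul_mul_smul_comm]
    norm_num
  have h1 : trNLinear τ (star (CStarMatrix.ofMatrix u) * x) =
      ((6 / 5 : ℝ) : ℂ) * trN τ (bᴴ * b) := by
    have h := trN_conjTranspose_mul_half_sub_transpose τ u
    rw [← hb] at h
    rw [← h, mul_smul_comm, map_smul, smul_eq_mul]
    norm_num
    rfl
  have h2 : trNLinear τ (star x * x) = ((36 / 25 : ℝ) : ℂ) * trN τ (bᴴ * b) := by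
    rw [hxx, map_smul, smul_eq_mul]
    rfl
  have h4 : trNLinear τ (star x * x * (star x * x)) =
      ((1296 / 625 : ℝ) : ℂ) * trN τ (bᴴ * b * (bᴴ * b)) := by
    rw [hxx, smul_mul_smul_comm, map_smul, smul_eq_mul, ← Complex.ofReal_mul]
    norm_num1
    rfl
  have hfour := three_halves_mul_sq_le τ hτ1 hτtr (fun a => (hτpos a).1) (b := b)
    (by rw [hb, transpose_smul, transpose_sub, transpose_transpose]; module)
  rw [h1, h2, h4] at hmain
  simp only [Complex.re_ofReal_mul] at hmain
  have h0 := (trN_conjTranspose_mul_self τ hτpos b).1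
  nlinarith

open scoped ComplexOrder in
lemma re_trace_partialAntisymm_le (k : ℕ) (hk : 1 ≤ k)
    {w : Matrix (Fin 3 × Fin k) (Fin 3 × Fin k) ℂ} (hw : w ∈ unitaryGroup (Fin 3 × Fin k) ℂ) :
    let bw : Matrix (Fin 3 × Fin k) (Fin 3 × Fin k) ℂ := of fun is jt =>
      (2 : ℂ)⁻¹ * (w is jt - w (jt.1, is.2) (is.1, jt.2))
    ((3 * k : ℂ)⁻¹ * trace (bwᴴ * bw)).re ≤ 25 / 27 := by
  intro bw
  let τ : CStarMatrix (Fin k) (Fin k) ℂ →ₗ[ℂ] ℂ :=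
    (k : ℂ)⁻¹ • (traceLinearMap (Fin k) ℂ ℂ ∘ₗ CStarMatrix.ofMatrixₗ.symm.toLinearMap)
  have hτ (a : CStarMatrix (Fin k) (Fin k) ℂ) : τ a = (k : ℂ)⁻¹ * ∑ i, a i i := rfl
  have hk0 : (k : ℂ) ≠ 0 := by exact_mod_cast (by omega : k ≠ 0)
  have hτ1 : τ 1 = 1 := by simp [hτ, hk0]
  have hτtr (a b : CStarMatrix (Fin k) (Fin k) ℂ) : τ (a * b) = τ (b * a) :=
    congrArg ((k : ℂ)⁻¹ * ·) (trace_mul_comm (CStarMatrix.ofMatrix.symm a)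
      (CStarMatrix.ofMatrix.symm b))
  have hτstar (a : CStarMatrix (Fin k) (Fin k) ℂ) :
      τ (star a * a) = (k : ℂ)⁻¹ * ∑ i, ∑ r, star (a r i) * a r i := by
    simp only [hτ, CStarMatrix.mul_apply, CStarMatrix.star_apply]
  have hτpos (a : CStarMatrix (Fin k) (Fin k) ℂ) :
      0 ≤ (τ (star a * a)).re ∧ (τ (star a * a)).im = 0 := by
    have h : 0 ≤ τ (star a * a) := by
      rw [hτstar]
      exact mul_nonneg (by simp) (Finset.sum_nonneg fun i _ => Finset.sum_nonneg fun r _ =>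
        star_mul_self_nonneg _)
    exact ⟨(Complex.nonneg_iff.mp h).1, (Complex.nonneg_iff.mp h).2.symm⟩
  let u : Matrix (Fin 3) (Fin 3) (CStarMatrix (Fin k) (Fin k) ℂ) :=
    fun i j => CStarMatrix.ofMatrix fun s t => w (i, s) (j, t)
  have hu : uᴴ * u = 1 ∧ u * uᴴ = 1 := by
    constructor
    · ext i j s t
      have h := congrFun (congrFun (mem_unitaryGroup_iff'.mp hw) (i, s)) (j, t)
      rw [Matrix.mul_apply, Fintype.sum_prod_type, Fin.sum_univ_three] at h
      rw [Matrix.mul_apply, Fin.sum_univ_three]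
      refine h.trans ?_
      by_cases hij : i = j
      · simp [hij, Matrix.one_apply, CStarMatrix.one_apply]
      · simp [hij]
    · ext i j s t
      have h := congrFun (congrFun (mem_unitaryGroup_iff.mp hw) (i, s)) (j, t)
      rw [Matrix.mul_apply, Fintype.sum_prod_type, Fin.sum_univ_three] at h
      rw [Matrix.mul_apply, Fin.sum_univ_three]
      refine h.trans ?_
      by_cases hij : i = j
      · simp [hij, Matrix.one_apply, CStarMatrix.one_apply]
      · simp [hij]
  have h := re_trN_le τ hτ1 hτtr hτpos u hu _ rfl
  convert h using 2
  simp only [trN, Matrix.mul_apply, map_sum, conjTranspose_apply, hτstar, trace, diag_apply]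
  simp only [Fintype.sum_prod_type]
  rw [mul_inv, mul_assoc]
  congr 1
  rw [Finset.mul_sum]
  refine Finset.sum_congr rfl fun i _ => ?_
  rw [← Finset.mul_sum, Finset.sum_comm]
  rfl

/-- for every unitary `u ∈ M₃(N)` over a unital C*-algebra (e.g. a finite
von Neumann algebra) with a faithful tracial state, the anti-symmetric part
`b = (u − uᵀ)/2` satisfies `‖b‖₂² = τ̃(bᴴb) ≤ 25/27`; in particular, in the
finite-dimensional case `N = M_k(ℂ)`: for every unitary `w ∈ M₃(ℂ) ⊗ M_k(ℂ)`, the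
anti-symmetric part (transpose taken in the `M₃` factor only) `bw` satisfies
`(τ₃ ⊗ τ_k)(bwᴴ bw) ≤ 25/27`. -/
theorem antisym_part_two_norm_bound {N : Type*} [CStarAlgebra N]
    (τ : N →ₗ[ℂ] ℂ) (hτ1 : τ 1 = 1) (hτtr : ∀ a b : N, τ (a * b) = τ (b * a))
    (hτpos : ∀ a : N, 0 ≤ (τ (star a * a)).re ∧ (τ (star a * a)).im = 0)
    (hτfaith : ∀ a : N, τ (star a * a) = 0 → a = 0)
    (u : Matrix (Fin 3) (Fin 3) N) (hu : uᴴ * u = 1 ∧ u * uᴴ = 1)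
    (b : Matrix (Fin 3) (Fin 3) N) (hb : b = (2 : ℂ)⁻¹ • (u - uᵀ)) :
    (trN τ (bᴴ * b)).re ≤ 25 / 27 ∧
    ∀ (k : ℕ), 1 ≤ k →
      ∀ w ∈ Matrix.unitaryGroup (Fin 3 × Fin k) ℂ,
      ∀ bw : Matrix (Fin 3 × Fin k) (Fin 3 × Fin k) ℂ,
        (bw = Matrix.of fun is jt =>
          (2 : ℂ)⁻¹ * (w is jt - w (jt.1, is.2) (is.1, jt.2))) →
        (((3 * k : ℂ))⁻¹ * Matrix.trace (bwᴴ * bw)).re ≤ 25 / 27 := by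
  refine ⟨re_trN_le τ hτ1 hτtr hτpos u hu b hb, fun k hk w hw bw hbw => ?_⟩
  subst hbw
  exact re_trace_partialAntisymm_le k hk hw

end
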